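/- arXiv:1907.04383 — 4 statements merged into one kernel-verified Lean document; each statement's English description precedes it below -/
import Mathlib

section
/- Let (𝐀,𝐁) be a promise template. Then the following are equivalent: (1) the BLP+Affine algorithm correctly solves PCSP-Decision(𝐀,𝐁); (2) (𝐀,𝐁) has block-symmetric polymorphisms of arbitrarily high width; (3) for every integer L ≥ 1, (𝐀,𝐁) has a polymorphism of arity 2L+1 that is block-symmetric with respect to a partition of [2L+1] into two blocks of sizes L and L+1. -/
/-- `σ` is a homomorphism between the relational structures given by `RX` and `RA`. -/
def IsHom {ι : Type} {ar : ι → ℕ} {X A : Type}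
    (RX : ∀ R : ι, Finset (Fin (ar R) → X))
    (RA : ∀ R : ι, Finset (Fin (ar R) → A)) (σ : X → A) : Prop :=
  ∀ R : ι, ∀ t ∈ RX R, (fun k => σ (t k)) ∈ RA R

/-- `(w, p)` is a solution of the basic LP relaxation of the instance `RX` over `RA`. -/
def IsBLPSol {ι : Type} {ar : ι → ℕ} {X A : Type} [Fintype A] [DecidableEq A]
    (RX : ∀ R : ι, Finset (Fin (ar R) → X))
    (RA : ∀ R : ι, Finset (Fin (ar R) → A))
    (w : X → A → ℚ)
    (p : ∀ R : ι, (Fin (ar R) → X) → (Fin (ar R) → A) → ℚ) : Prop :=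
  (∀ i a, 0 ≤ w i a) ∧
  (∀ R : ι, ∀ xb ∈ RX R, ∀ y ∈ RA R, 0 ≤ p R xb y) ∧
  (∀ i, ∑ a, w i a = 1) ∧
  (∀ R : ι, ∀ xb ∈ RX R, ∑ y ∈ RA R, p R xb y = 1) ∧
  (∀ R : ι, ∀ xb ∈ RX R, ∀ (k : Fin (ar R)) (a : A),
    ∑ y ∈ (RA R).filter (fun y => y k = a), p R xb y = w (xb k) a)

/-- `(r, q)` is a solution of the affine (integral) relaxation of the instance `RX` over `RA`. -/
def IsAffSol {ι : Type} {ar : ι → ℕ} {X A : Type} [Fintype A] [DecidableEq A]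
    (RX : ∀ R : ι, Finset (Fin (ar R) → X))
    (RA : ∀ R : ι, Finset (Fin (ar R) → A))
    (r : X → A → ℤ)
    (q : ∀ R : ι, (Fin (ar R) → X) → (Fin (ar R) → A) → ℤ) : Prop :=
  (∀ i, ∑ a, r i a = 1) ∧
  (∀ R : ι, ∀ xb ∈ RX R, ∑ y ∈ RA R, q R xb y = 1) ∧
  (∀ R : ι, ∀ xb ∈ RX R, ∀ (k : Fin (ar R)) (a : A),
    ∑ y ∈ (RA R).filter (fun y => y k = a), q R xb y = r (xb k) a)

/-- The affine solution `(r, q)` refines the BLP solution `(w, p)`. -/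
def Refines {ι : Type} {ar : ι → ℕ} {X A : Type}
    (RX : ∀ R : ι, Finset (Fin (ar R) → X))
    (RA : ∀ R : ι, Finset (Fin (ar R) → A))
    (w : X → A → ℚ)
    (p : ∀ R : ι, (Fin (ar R) → X) → (Fin (ar R) → A) → ℚ)
    (r : X → A → ℤ)
    (q : ∀ R : ι, (Fin (ar R) → X) → (Fin (ar R) → A) → ℤ) : Prop :=
  (∀ i a, w i a = 0 → r i a = 0) ∧
  (∀ R : ι, ∀ xb ∈ RX R, ∀ y ∈ RA R, p R xb y = 0 → q R xb y = 0)

/-- The BLP+Affine algorithm accepts the instance `RX` (with respect to `RA`):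
there is a BLP solution together with an affine solution refining it. -/
def Accepts {ι : Type} {ar : ι → ℕ} {X A : Type} [Fintype A] [DecidableEq A]
    (RX : ∀ R : ι, Finset (Fin (ar R) → X))
    (RA : ∀ R : ι, Finset (Fin (ar R) → A)) : Prop :=
  ∃ w p r q, IsBLPSol RX RA w p ∧ IsAffSol RX RA r q ∧ Refines RX RA w p r q

/-- `f` is a polymorphism of the promise template given by relations `RA`, `RB`. -/
def IsPolymorphism {ι : Type} {ar : ι → ℕ} {A B : Type}
    (RA : ∀ R : ι, Finset (Fin (ar R) → A)) (RB : ∀ R : ι, Finset (Fin (ar R) → B))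
    {L : ℕ} (f : (Fin L → A) → B) : Prop :=
  ∀ R : ι, ∀ x : Fin L → (Fin (ar R) → A), (∀ l, x l ∈ RA R) →
    (fun k => f (fun l => x l k)) ∈ RB R

/-- `f` is block-symmetric with respect to the partition of `Fin L` into the
fibers of `blk`: it is invariant under all permutations preserving each fiber. -/
def IsBlockSymmetric {A B : Type} {L κ : ℕ} (blk : Fin L → Fin κ)
    (f : (Fin L → A) → B) : Prop :=
  ∀ π : Equiv.Perm (Fin L), (∀ i, blk (π i) = blk i) →
    ∀ x : Fin L → A, f (x ∘ π) = f x

open Finset in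
/-- Summing the fiber cardinalities of `x` over the fiber of `g` above `a` counts the fiber of
`g ∘ x` above `a`. -/
theorem sum_card_fiber_filter {I Y A : Type*} [DecidableEq Y] [DecidableEq A] (T : Finset I)
    {x : I → Y} {S : Finset Y} (hx : ∀ l, x l ∈ S) (g : Y → A) (a : A) :
    ∑ y ∈ S.filter (fun y => g y = a), (T.filter (fun l => x l = y)).card =
      (T.filter (fun l => g (x l) = a)).card := by
  rw [card_eq_sum_card_fiberwise (f := x) (t := S.filter (fun y => g y = a))]
  · refine sum_congr rfl fun y hy => ?_
    rw [filter_filter]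
    congr 1
    ext l
    simp only [mem_filter] at hy ⊢
    constructor
    · rintro ⟨h₁, rfl⟩
      exact ⟨h₁, hy.2, rfl⟩
    · rintro ⟨h₁, -, h₂⟩
      exact ⟨h₁, h₂⟩
  · intro l hl
    simp only [coe_filter, Set.mem_ofPred_eq] at hl ⊢
    exact ⟨hx l, hl.2⟩

open Finset in
/-- Summing all the fiber cardinalities of `x` on `T` counts `T`. -/
theorem sum_card_fiber {I Y : Type*} [DecidableEq Y] (T : Finset I)
    {x : I → Y} {S : Finset Y} (hx : ∀ l, x l ∈ S) :
    ∑ y ∈ S, (T.filter (fun l => x l = y)).card = T.card :=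
  (card_eq_sum_card_fiberwise fun l _ => hx l).symm

open Finset in
/-- Functions with the same fiber cardinalities differ by a permutation. -/
theorem exists_perm_of_card_fiber_eq {I C : Type*} [Fintype I] [DecidableEq C] {g h : I → C}
    (hgh : ∀ c, (univ.filter (fun l => g l = c)).card = (univ.filter (fun l => h l = c)).card) :
    ∃ π : Equiv.Perm I, ∀ l, h (π l) = g l := by
  have e : ∀ c, Nonempty ({l // g l = c} ≃ {l // h l = c}) := fun c =>
    Fintype.card_eq.1 (by simpa only [Fintype.card_subtype] using hgh c)
  exact ⟨Equiv.ofFiberEquiv fun c => (e c).some, Equiv.ofFiberEquiv_map _⟩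

open Finset in
/-- A block-symmetric map takes equal values on tuples with equal counts in every block. -/
theorem IsBlockSymmetric.eq_of_card_eq {A B : Type} [DecidableEq A] {L κ : ℕ}
    {blk : Fin L → Fin κ} {f : (Fin L → A) → B} (hf : IsBlockSymmetric blk f) {z z' : Fin L → A}
    (h : ∀ b a, ((univ.filter (fun l => blk l = b)).filter (fun l => z l = a)).card =
      ((univ.filter (fun l => blk l = b)).filter (fun l => z' l = a)).card) :
    f z = f z' := by
  obtain ⟨π, hπ⟩ := exists_perm_of_card_fiber_eq
    (g := fun l => (blk l, z l)) (h := fun l => (blk l, z' l)) (by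
      rintro ⟨b, a⟩
      simpa only [Prod.mk.injEq, filter_filter] using h b a)
  simp only [Prod.mk.injEq] at hπ
  rw [← hf π (fun i => (hπ i).1) z']
  congr 1
  funext l
  exact (hπ l).2.symm

open Finset in
/-- There is a tuple of elements of `S` with prescribed counts in every block. -/
theorem exists_forall_card_fiber_eq {I K Y : Type*} [Fintype I] [DecidableEq K] [DecidableEq Y]
    (blk : I → K) (S : Finset Y) (c : K → Y → ℕ)
    (hc : ∀ b, ∑ y ∈ S, c b y = (univ.filter (fun l => blk l = b)).card) :
    ∃ x : I → Y, (∀ l, x l ∈ S) ∧ ∀ b, ∀ y ∈ S,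
      ((univ.filter (fun l => blk l = b)).filter (fun l => x l = y)).card = c b y := by
  have e : ∀ b, Nonempty ({l // blk l = b} ≃ Σ y : S, Fin (c b y)) := fun b =>
    Fintype.card_eq.1 (by
      rw [Fintype.card_subtype, ← hc b, Fintype.card_sigma, ← Finset.sum_coe_sort]
      simp)
  let E := fun b => (e b).some
  refine ⟨fun l => (E (blk l) ⟨l, rfl⟩).1, fun l => (E (blk l) ⟨l, rfl⟩).1.2, fun b y hy => ?_⟩
  have h₁ : Fintype.card {s : {l // blk l = b} // (E b s).1 = ⟨y, hy⟩} = c b y := by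
    rw [Fintype.card_congr ((E b).subtypeEquiv (q := fun s => s.1 = ⟨y, hy⟩) fun _ => Iff.rfl),
      Fintype.card_congr (Equiv.sigmaSubtype (⟨y, hy⟩ : S)), Fintype.card_fin]
  rw [← h₁, filter_filter, ← Fintype.card_subtype]
  refine (Fintype.card_congr ((Equiv.subtypeSubtypeEquivSubtypeExists _ _).trans
    (Equiv.subtypeEquivRight fun l => ?_))).symm
  constructor
  · rintro ⟨rfl, h⟩
    exact ⟨rfl, congrArg Subtype.val h⟩
  · rintro ⟨rfl, h⟩
    exact ⟨rfl, Subtype.ext h⟩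

/-- A finite family of rationals has a common positive denominator. -/
theorem exists_common_denominator {J : Type*} [Finite J] (g : J → ℚ) :
    ∃ M : ℕ, 0 < M ∧ ∀ j, ∃ n : ℤ, (M : ℚ) * g j = n := by
  cases nonempty_fintype J
  refine ⟨∏ j, (g j).den, Finset.prod_pos fun j _ => (g j).den_pos, fun j => ?_⟩
  obtain ⟨d, hd⟩ := Finset.dvd_prod_of_mem (fun j => (g j).den) (Finset.mem_univ j)
  refine ⟨d * (g j).num, ?_⟩
  rw [hd]
  push_cast
  linear_combination (d : ℚ) * Rat.den_mul_eq_num (g j)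

/-- A finite family of integers is bounded in absolute value. -/
theorem exists_forall_abs_le {J : Type*} [Finite J] (g : J → ℤ) :
    ∃ K : ℕ, ∀ j, |g j| ≤ K := by
  cases nonempty_fintype J
  refine ⟨∑ j, (g j).natAbs, fun j => ?_⟩
  have := Finset.single_le_sum (f := fun j => (g j).natAbs) (fun _ _ => Nat.zero_le _)
    (Finset.mem_univ j)
  rw [Int.abs_eq_natAbs]
  exact_mod_cast this

theorem mul_add_mul_nonneg_of_bound {u v M K a q : ℤ} (ha : 0 ≤ a) (h0 : a = 0 → q = 0)
    (hq : |q| ≤ K) (hv : 0 ≤ v) (hvM : v ≤ M) (hu : M * K ≤ u) : 0 ≤ u * a + v * q := by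
  have hK : 0 ≤ K := (abs_nonneg q).trans hq
  rcases ha.eq_or_lt with h | h
  · simp [h0 h.symm, ← h]
  · have h₁ : v * -q ≤ M * K :=
      (mul_le_mul_of_nonneg_left ((neg_le_abs q).trans hq) hv).trans
        (mul_le_mul_of_nonneg_right hvM hK)
    have h₂ : u * 1 ≤ u * a :=
      mul_le_mul_of_nonneg_left h ((mul_nonneg (hv.trans hvM) hK).trans hu)
    linarith

/-- On an accepted instance, for every large enough total weight there are compatible natural
number weights on variables and constraints. -/
theorem Accepts.exists_nat_weights {ι : Type} [Fintype ι] {ar : ι → ℕ} {X A : Type} [Fintype X]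
    [Fintype A] [DecidableEq A] {RX : ∀ R : ι, Finset (Fin (ar R) → X)}
    {RA : ∀ R : ι, Finset (Fin (ar R) → A)} (h : Accepts RX RA) :
    ∃ N : ℕ, ∀ n, N ≤ n → ∃ (W : X → A → ℕ) (P : ∀ R : ι, (Fin (ar R) → X) →
        (Fin (ar R) → A) → ℕ),
      (∀ i, ∑ a, W i a = n) ∧
      (∀ R, ∀ xb ∈ RX R, ∑ y ∈ RA R, P R xb y = n) ∧
      (∀ R, ∀ xb ∈ RX R, ∀ k a,
        ∑ y ∈ (RA R).filter (fun y => y k = a), P R xb y = W (xb k) a) := by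
  obtain ⟨w, p, r, q, ⟨hw0, hp0, hw1, hp1, hpw⟩, ⟨hr1, hq1, hqr⟩, hwr, hpq⟩ := h
  let J := (X × A) ⊕ (Σ R : ι, (Fin (ar R) → X) × (Fin (ar R) → A))
  obtain ⟨M, hM, hMg⟩ := exists_common_denominator (J := J)
    (Sum.elim (fun s => w s.1 s.2) fun s => p s.1 s.2.1 s.2.2)
  obtain ⟨K, hK⟩ := exists_forall_abs_le (J := J)
    (Sum.elim (fun s => r s.1 s.2) fun s => q s.1 s.2.1 s.2.2)
  choose g hg using hMg
  let wz : X → A → ℤ := fun i a => g (Sum.inl (i, a))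
  let pz : ∀ R : ι, (Fin (ar R) → X) → (Fin (ar R) → A) → ℤ :=
    fun R xb y => g (Sum.inr ⟨R, xb, y⟩)
  have hwz : ∀ i a, (M : ℚ) * w i a = wz i a := fun i a => hg (Sum.inl (i, a))
  have hpz : ∀ R xb y, (M : ℚ) * p R xb y = pz R xb y :=
    fun R xb y => hg (Sum.inr ⟨R, xb, y⟩)
  have hr : ∀ i a, |r i a| ≤ K := fun i a => hK (Sum.inl (i, a))
  have hq : ∀ R xb y, |q R xb y| ≤ K := fun R xb y => hK (Sum.inr ⟨R, xb, y⟩)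
  have hMQ : (0 : ℚ) < M := by exact_mod_cast hM
  have scale_nonneg : ∀ {s : ℚ} {t : ℤ}, (M : ℚ) * s = t → 0 ≤ s → 0 ≤ t := by
    intro s t hst hs
    have : (0 : ℚ) ≤ t := hst ▸ mul_nonneg hMQ.le hs
    exact_mod_cast this
  have scale_zero : ∀ {s : ℚ} {t : ℤ}, (M : ℚ) * s = t → t = 0 → s = 0 := by
    intro s t hst ht
    rw [ht, Int.cast_zero] at hst
    exact (mul_eq_zero.1 hst).resolve_left hMQ.ne'
  have hwz1 : ∀ i, ∑ a, wz i a = M := fun i => by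
    have : ((∑ a, wz i a : ℤ) : ℚ) = M := by
      push_cast
      simp only [← hwz, ← Finset.mul_sum, hw1, mul_one]
    exact_mod_cast this
  have hpz1 : ∀ R, ∀ xb ∈ RX R, ∑ y ∈ RA R, pz R xb y = M := fun R xb hxb => by
    have : ((∑ y ∈ RA R, pz R xb y : ℤ) : ℚ) = M := by
      push_cast
      simp only [← hpz, ← Finset.mul_sum, hp1 R xb hxb, mul_one]
    exact_mod_cast this
  have hpwz : ∀ R, ∀ xb ∈ RX R, ∀ k a,
      ∑ y ∈ (RA R).filter (fun y => y k = a), pz R xb y = wz (xb k) a := fun R xb hxb k a => by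
    have : ((∑ y ∈ (RA R).filter (fun y => y k = a), pz R xb y : ℤ) : ℚ) = wz (xb k) a := by
      push_cast
      simp only [← hpz, ← hwz, ← Finset.mul_sum, hpw R xb hxb]
    exact_mod_cast this
  refine ⟨M * K * M, fun n hn => ?_⟩
  obtain ⟨u, v, hu, hvM, huv⟩ : ∃ u v : ℕ, (M : ℤ) * K ≤ u ∧ (v : ℤ) ≤ M ∧
      (u : ℤ) * M + v * 1 = n :=
    ⟨n / M, n % M, by exact_mod_cast (Nat.le_div_iff_mul_le hM).2 hn,
      by exact_mod_cast (Nat.mod_lt n hM).le,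
      by rw [mul_one]; exact_mod_cast Nat.div_add_mod' n M⟩
  have hW : ∀ i a, 0 ≤ (u : ℤ) * wz i a + (v : ℤ) * r i a := fun i a =>
    mul_add_mul_nonneg_of_bound (scale_nonneg (hwz i a) (hw0 i a))
      (fun h => hwr i a (scale_zero (hwz i a) h)) (hr i a) (Int.natCast_nonneg _) hvM hu
  have hP : ∀ R, ∀ xb ∈ RX R, ∀ y ∈ RA R,
      0 ≤ (u : ℤ) * pz R xb y + (v : ℤ) * q R xb y := fun R xb hxb y hy =>
    mul_add_mul_nonneg_of_bound (scale_nonneg (hpz R xb y) (hp0 R xb hxb y hy))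
      (fun h => hpq R xb hxb y hy (scale_zero (hpz R xb y) h)) (hq R xb y)
      (Int.natCast_nonneg _) hvM hu
  refine ⟨fun i a => ((u : ℤ) * wz i a + (v : ℤ) * r i a).toNat,
    fun R xb y => ((u : ℤ) * pz R xb y + (v : ℤ) * q R xb y).toNat,
    fun i => ?_, fun R xb hxb => ?_, fun R xb hxb k a => ?_⟩
  · zify
    rw [Finset.sum_congr rfl fun a _ => Int.toNat_of_nonneg (hW i a), Finset.sum_add_distrib,
      ← Finset.mul_sum, ← Finset.mul_sum, hwz1, hr1, huv]
  · zify
    rw [Finset.sum_congr rfl fun y hy => Int.toNat_of_nonneg (hP R xb hxb y hy),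
      Finset.sum_add_distrib, ← Finset.mul_sum, ← Finset.mul_sum, hpz1 R xb hxb, hq1 R xb hxb,
      huv]
  · zify
    rw [Finset.sum_congr rfl fun y hy =>
        Int.toNat_of_nonneg (hP R xb hxb y (Finset.mem_filter.1 hy).1),
      Finset.sum_add_distrib, ← Finset.mul_sum, ← Finset.mul_sum, hpwz R xb hxb, hqr R xb hxb,
      Int.toNat_of_nonneg (hW _ _)]

open Finset in
/-- Block-symmetric polymorphisms of arbitrarily high width round accepted instances. -/
theorem Accepts.exists_isHom {ι : Type} [Fintype ι] {ar : ι → ℕ} {X A B : Type} [Fintype X]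
    [Fintype A] [DecidableEq A] {RX : ∀ R : ι, Finset (Fin (ar R) → X)}
    {RA : ∀ R : ι, Finset (Fin (ar R) → A)} {RB : ∀ R : ι, Finset (Fin (ar R) → B)}
    (hpol : ∀ N : ℕ, ∃ (L κ : ℕ) (blk : Fin L → Fin κ) (f : (Fin L → A) → B),
        (∀ b, N ≤ (univ.filter (fun i => blk i = b)).card) ∧
        IsPolymorphism RA RB f ∧ IsBlockSymmetric blk f)
    (h : Accepts RX RA) : ∃ σ : X → B, IsHom RX RB σ := by
  obtain ⟨N, hN⟩ := h.exists_nat_weights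
  obtain ⟨L, κ, blk, f, hblk, hf, hsym⟩ := hpol N
  choose W P hW hP hPW using fun b => hN _ (hblk b)
  have hz : ∀ i, ∃ z : Fin L → A, ∀ b a,
      ((univ.filter (fun l => blk l = b)).filter (fun l => z l = a)).card = W b i a := fun i => by
    obtain ⟨z, -, hz⟩ := exists_forall_card_fiber_eq blk univ (fun b => W b i) fun b => hW b i
    exact ⟨z, fun b a => hz b a (mem_univ a)⟩
  choose z hz using hz
  refine ⟨fun i => f (z i), fun R xb hxb => ?_⟩
  obtain ⟨x, hxS, hx⟩ := exists_forall_card_fiber_eq blk (RA R) (fun b => P b R xb)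
    fun b => hP b R xb hxb
  convert hf R x hxS using 2 with k
  refine hsym.eq_of_card_eq fun b a => ?_
  rw [hz, ← hPW b R xb hxb k a, ← sum_card_fiber_filter _ hxS (fun y => y k) a]
  exact sum_congr rfl fun y hy => (hx b y (mem_filter.1 hy).1).symm

/-- An instance with a homomorphism to `𝐀` is accepted. -/
theorem accepts_of_isHom {ι : Type} {ar : ι → ℕ} {X A : Type}
    [Fintype A] [DecidableEq A] {RX : ∀ R : ι, Finset (Fin (ar R) → X)}
    {RA : ∀ R : ι, Finset (Fin (ar R) → A)} {σ : X → A} (hσ : IsHom RX RA σ) :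
    Accepts RX RA := by
  refine ⟨fun i a => if a = σ i then 1 else 0,
    fun R xb y => if y = (fun k => σ (xb k)) then 1 else 0,
    fun i a => if a = σ i then 1 else 0,
    fun R xb y => if y = (fun k => σ (xb k)) then 1 else 0,
    ⟨fun i a => by positivity, fun R xb _ y _ => by positivity, fun i => by simp,
      fun R xb hxb => ?_, fun R xb hxb k a => ?_⟩,
    ⟨fun i => by simp, fun R xb hxb => ?_, fun R xb hxb k a => ?_⟩,
    fun i a h => by simpa using h, fun R xb _ y _ h => by simpa using h⟩
  all_goals simp [Finset.sum_ite_eq', hσ R xb hxb, eq_comm]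

open Finset in
/-- If every accepted instance has a homomorphism to `𝐁`, then there are polymorphisms which are
symmetric on two blocks of consecutive sizes. -/
theorem exists_isPolymorphism_isBlockSymmetric {ι : Type} {ar : ι → ℕ} {A B : Type}
    [Fintype A] [DecidableEq A]
    {RA : ∀ R : ι, Finset (Fin (ar R) → A)} {RB : ∀ R : ι, Finset (Fin (ar R) → B)}
    (h : ∀ (X : Type) [Fintype X] (RX : ∀ R : ι, Finset (Fin (ar R) → X)),
        Accepts RX RA → ∃ σ : X → B, IsHom RX RB σ)
    {n : ℕ} (blk : Fin n → Fin 2)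
    (hblk : (univ.filter (fun i => blk i = 1)).card = (univ.filter (fun i => blk i = 0)).card + 1) :
    ∃ f : (Fin n → A) → B, IsPolymorphism RA RB f ∧ IsBlockSymmetric blk f := by
  classical
  let T : Fin 2 → Finset (Fin n) := fun b => univ.filter (fun i => blk i = b)
  have hT : (T 1).card = (T 0).card + 1 := hblk
  let cnt : (Fin n → A) → Fin 2 → A → ℕ := fun z b a => ((T b).filter (fun l => z l = a)).card
  let X := Set.range cnt
  let _ : Fintype X := Fintype.ofFinite X
  let tup : ∀ R, (Fin n → RA R) → Fin (ar R) → X := fun R x k => ⟨cnt fun l => (x l).1 k, _, rfl⟩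
  let RX : ∀ R : ι, Finset (Fin (ar R) → X) := fun R => univ.image (tup R)
  have hcnt : ∀ (v : X) b, ∑ a, v.1 b a = (T b).card := by
    rintro ⟨_, z, rfl⟩ b
    exact sum_card_fiber (T b) fun l => mem_univ (z l)
  have hpre : ∀ R (t : Fin (ar R) → X), ∃ c : Fin 2 → (Fin (ar R) → A) → ℕ, t ∈ RX R →
      (∀ b, ∑ y ∈ RA R, c b y = (T b).card) ∧
      ∀ b k a, ∑ y ∈ (RA R).filter (fun y => y k = a), c b y = (t k).1 b a := by
    intro R t
    by_cases ht : t ∈ RX R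
    · obtain ⟨x, -, rfl⟩ := mem_image.1 ht
      have hx : ∀ l, (x l).1 ∈ RA R := fun l => (x l).2
      exact ⟨fun b y => ((T b).filter (fun l => (x l).1 = y)).card, fun _ =>
        ⟨fun b => sum_card_fiber (T b) hx,
          fun b k a => sum_card_fiber_filter (T b) hx (fun y => y k) a⟩⟩
    · exact ⟨0, fun h => absurd h ht⟩
  choose c hc using hpre
  have hpos : (0 : ℚ) < (T 0).card + (T 1).card := by
    rw [hT]
    positivity
  have hrefine : ∀ s t : ℕ, ((s : ℚ) + t) / ((T 0).card + (T 1).card) = 0 → (t : ℤ) - s = 0 := by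
    intro s t hst
    have : (s : ℚ) + t = 0 := (div_eq_zero_iff.1 hst).resolve_right hpos.ne'
    have : s + t = 0 := by exact_mod_cast this
    lia
  obtain ⟨σ, hσ⟩ := h X RX
    ⟨fun v a => ((v.1 0 a : ℚ) + v.1 1 a) / ((T 0).card + (T 1).card),
      fun R t y => ((c R t 0 y : ℚ) + c R t 1 y) / ((T 0).card + (T 1).card),
      fun v a => v.1 1 a - v.1 0 a, fun R t y => c R t 1 y - c R t 0 y,
      ⟨fun v a => by positivity, fun R t _ y _ => by positivity, fun v => by
          rw [← sum_div, sum_add_distrib, ← Nat.cast_sum, ← Nat.cast_sum, hcnt, hcnt,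
            div_self hpos.ne'],
        fun R t ht => by
          rw [← sum_div, sum_add_distrib, ← Nat.cast_sum, ← Nat.cast_sum, (hc R t ht).1,
            (hc R t ht).1, div_self hpos.ne'],
        fun R t ht k a => by
          rw [← sum_div, sum_add_distrib, ← Nat.cast_sum, ← Nat.cast_sum, (hc R t ht).2,
            (hc R t ht).2]⟩,
      ⟨fun v => by
          rw [sum_sub_distrib, ← Nat.cast_sum, ← Nat.cast_sum, hcnt, hcnt, hT]
          simp,
        fun R t ht => by
          rw [sum_sub_distrib, ← Nat.cast_sum, ← Nat.cast_sum, (hc R t ht).1, (hc R t ht).1, hT]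
          simp,
        fun R t ht k a => by
          rw [sum_sub_distrib, ← Nat.cast_sum, ← Nat.cast_sum, (hc R t ht).2, (hc R t ht).2]⟩,
      fun v a => hrefine _ _, fun R t _ y _ => hrefine _ _⟩
  refine ⟨fun z => σ ⟨cnt z, z, rfl⟩, fun R x hx => ?_, fun π hπ z => ?_⟩
  · exact hσ R _ (mem_image_of_mem (tup R) (mem_univ fun l => ⟨x l, hx l⟩))
  · refine congrArg σ (Subtype.ext (funext₂ fun b a => ?_))
    change ((T b).filter (fun l => (z ∘ π) l = a)).card = ((T b).filter (fun l => z l = a)).card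
    refine card_equiv π fun l => ?_
    simp [T, hπ]

/-- For a promise template `(𝐀,𝐁)` (finite signature `ι` with arities
`ar`, finite domains `A`, `B`, with a homomorphism from `𝐀` to `𝐁`), the following are
equivalent: (1) the BLP+Affine algorithm correctly solves `PCSP-Decision(𝐀,𝐁)`;
(2) `(𝐀,𝐁)` has block-symmetric polymorphisms of arbitrarily high width;
(3) for every `L ≥ 1` there is a polymorphism of arity `2L+1` block-symmetric with
respect to a partition of `[2L+1]` into two blocks of sizes `L` and `L+1`. -/
theorem stmt_0 {ι : Type} [Fintype ι] {ar : ι → ℕ} (har : ∀ R, 1 ≤ ar R)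
    {A B : Type} [Fintype A] [DecidableEq A] [Fintype B]
    (RA : ∀ R : ι, Finset (Fin (ar R) → A))
    (RB : ∀ R : ι, Finset (Fin (ar R) → B))
    (hAB : ∃ h : A → B, IsHom RA RB h) :
    ((∀ (X : Type) [Fintype X] (RX : ∀ R : ι, Finset (Fin (ar R) → X)),
        ((∃ σ : X → A, IsHom RX RA σ) → Accepts RX RA) ∧
        (Accepts RX RA → ∃ σ : X → B, IsHom RX RB σ)) ↔
      (∀ N : ℕ, ∃ (L κ : ℕ) (blk : Fin L → Fin κ) (f : (Fin L → A) → B),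
        (∀ b, N ≤ (Finset.univ.filter (fun i => blk i = b)).card) ∧
        IsPolymorphism RA RB f ∧ IsBlockSymmetric blk f)) ∧
    ((∀ (X : Type) [Fintype X] (RX : ∀ R : ι, Finset (Fin (ar R) → X)),
        ((∃ σ : X → A, IsHom RX RA σ) → Accepts RX RA) ∧
        (Accepts RX RA → ∃ σ : X → B, IsHom RX RB σ)) ↔
      (∀ L : ℕ, 1 ≤ L →
        ∃ (blk : Fin (2 * L + 1) → Fin 2) (f : (Fin (2 * L + 1) → A) → B),
          (Finset.univ.filter (fun i => blk i = 0)).card = L ∧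
          (Finset.univ.filter (fun i => blk i = 1)).card = L + 1 ∧
          IsPolymorphism RA RB f ∧ IsBlockSymmetric blk f)) := by
  have solves : (∀ N : ℕ, ∃ (L κ : ℕ) (blk : Fin L → Fin κ) (f : (Fin L → A) → B),
        (∀ b, N ≤ (Finset.univ.filter (fun i => blk i = b)).card) ∧
        IsPolymorphism RA RB f ∧ IsBlockSymmetric blk f) →
      ∀ (X : Type) [Fintype X] (RX : ∀ R : ι, Finset (Fin (ar R) → X)),
        ((∃ σ : X → A, IsHom RX RA σ) → Accepts RX RA) ∧
        (Accepts RX RA → ∃ σ : X → B, IsHom RX RB σ) := fun hpol X _ RX =>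
    ⟨fun ⟨_, hσ⟩ => accepts_of_isHom hσ, fun h => h.exists_isHom hpol⟩
  have two_blocks : (∀ (X : Type) [Fintype X] (RX : ∀ R : ι, Finset (Fin (ar R) → X)),
        ((∃ σ : X → A, IsHom RX RA σ) → Accepts RX RA) ∧
        (Accepts RX RA → ∃ σ : X → B, IsHom RX RB σ)) →
      ∀ L : ℕ, 1 ≤ L →
        ∃ (blk : Fin (2 * L + 1) → Fin 2) (f : (Fin (2 * L + 1) → A) → B),
          (Finset.univ.filter (fun i => blk i = 0)).card = L ∧
          (Finset.univ.filter (fun i => blk i = 1)).card = L + 1 ∧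
          IsPolymorphism RA RB f ∧ IsBlockSymmetric blk f := by
    intro h L _
    let blk : Fin (2 * L + 1) → Fin 2 := fun i => if i.val < L then 0 else 1
    have h0 : (Finset.univ.filter (fun i => blk i = 0)).card = L := by
      simp only [blk, ite_eq_left_iff, one_ne_zero, imp_false, not_not]
      rw [Fin.card_filter_val_lt]
      lia
    have h1 : (Finset.univ.filter (fun i => blk i = 1)).card = L + 1 := by
      have := Finset.card_filter_add_card_filter_not (s := Finset.univ) (fun i => blk i = 0)
      have h01 : ∀ b : Fin 2, ¬b = 0 ↔ b = 1 := by decide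
      rw [h0, Finset.card_univ, Fintype.card_fin] at this
      simp only [h01] at this
      lia
    obtain ⟨f, hf⟩ := exists_isPolymorphism_isBlockSymmetric (fun X _ RX => (h X RX).2) blk
      (h1.trans (by rw [h0]))
    exact ⟨blk, f, h0, h1, hf⟩
  have wide : (∀ L : ℕ, 1 ≤ L →
        ∃ (blk : Fin (2 * L + 1) → Fin 2) (f : (Fin (2 * L + 1) → A) → B),
          (Finset.univ.filter (fun i => blk i = 0)).card = L ∧
          (Finset.univ.filter (fun i => blk i = 1)).card = L + 1 ∧
          IsPolymorphism RA RB f ∧ IsBlockSymmetric blk f) →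
      ∀ N : ℕ, ∃ (L κ : ℕ) (blk : Fin L → Fin κ) (f : (Fin L → A) → B),
        (∀ b, N ≤ (Finset.univ.filter (fun i => blk i = b)).card) ∧
        IsPolymorphism RA RB f ∧ IsBlockSymmetric blk f := by
    intro h N
    obtain ⟨blk, f, h0, h1, hf⟩ := h (N + 1) (Nat.le_add_left 1 N)
    refine ⟨_, 2, blk, f, Fin.forall_fin_two.2 ⟨?_, ?_⟩, hf⟩ <;> lia
  exact ⟨⟨fun h => wide (two_blocks h), solves⟩, ⟨two_blocks, fun h => solves (wide h)⟩⟩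
end

section
/- Let (𝐀,𝐁) be a promise template over finite domains such that for every N there exists a symmetric polymorphism of (𝐀,𝐁) of arity at least N. Let 𝐗 be any instance. If there exist a BLP solution (w,p) for (𝐗,𝐀) and an affine solution (r,q) refining (w,p), then there exists a homomorphism from 𝐗 to 𝐁. -/
/-- `f` is a symmetric function: invariant under all permutations of its arguments. -/
def IsSymmetric {A B : Type} {L : ℕ} (f : (Fin L → A) → B) : Prop :=
  ∀ (π : Equiv.Perm (Fin L)) (x : Fin L → A), f (x ∘ π) = f x

/-- Every long enough length `L` splits as `α + s` so that all the combinations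
`α * u j + s * v j` of a nonnegative rational vector `u` and an integer vector `v`
supported on the support of `u` are natural numbers. -/
lemma exists_add_eq_forall_natCast_eq {J : Type*} [Fintype J] (u : J → ℚ) (v : J → ℤ)
    (hu : ∀ j, 0 ≤ u j) (huv : ∀ j, u j = 0 → v j = 0) :
    ∃ N : ℕ, ∀ L ≥ N, ∃ α s : ℕ, α + s = L ∧
      ∀ j, ∃ n : ℕ, (n : ℚ) = α * u j + s * v j := by
  classical
  set D : ℕ := ∏ j, (u j).den with hD
  have hDpos : 0 < D := Finset.prod_pos fun j _ => (u j).pos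
  have hint : ∀ j, ∃ z : ℕ, (z : ℚ) = D * u j := by
    intro j
    obtain ⟨e, he⟩ : (u j).den ∣ D := Finset.dvd_prod_of_mem _ (Finset.mem_univ j)
    refine ⟨e * (u j).num.toNat, ?_⟩
    have hnum : (((u j).num.toNat : ℤ) : ℚ) = (u j).num := by
      rw [Int.toNat_of_nonneg (Rat.num_nonneg.2 (hu j))]
    have hmul : u j * (u j).den = (u j).num := Rat.mul_den_eq_num (u j)
    rw [he]
    push_cast at hnum ⊢
    rw [hnum, ← hmul]
    ring
  choose z hz using hint
  set M : ℕ := ∑ j, (v j).natAbs with hM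
  refine ⟨D * (D * M), fun L hL => ⟨D * (L / D), L % D, Nat.div_add_mod L D, fun j => ?_⟩⟩
  set c := L / D with hc
  set s := L % D with hs
  have hcM : D * M ≤ c := (Nat.le_div_iff_mul_le hDpos).2 (by rwa [mul_comm])
  have hsD : s ≤ D := (Nat.mod_lt L hDpos).le
  have hnonneg : (0 : ℤ) ≤ c * z j + s * v j := by
    by_cases h0 : u j = 0
    · rw [huv j h0]; positivity
    have hz1 : 1 ≤ z j := by
      refine Nat.one_le_iff_ne_zero.2 fun hzero => h0 ?_
      have := hz j
      rw [hzero, Nat.cast_zero, eq_comm, mul_eq_zero] at this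
      exact this.resolve_left (by exact_mod_cast hDpos.ne')
    have hvM : (v j).natAbs ≤ M :=
      Finset.single_le_sum (f := fun j => (v j).natAbs) (fun _ _ => Nat.zero_le _)
        (Finset.mem_univ j)
    have h1 : s * (v j).natAbs ≤ c * z j :=
      calc s * (v j).natAbs ≤ D * M := Nat.mul_le_mul hsD hvM
        _ ≤ c := hcM
        _ ≤ c * z j := Nat.le_mul_of_pos_right _ hz1
    have h2 : (s : ℤ) * (v j).natAbs ≤ c * z j := by exact_mod_cast h1
    have h3 : -((v j).natAbs : ℤ) ≤ v j := by omega
    nlinarith [mul_le_mul_of_nonneg_left h3 (Int.natCast_nonneg s)]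
  refine ⟨((c : ℤ) * z j + s * v j).toNat, ?_⟩
  have hcast : ((((c : ℤ) * z j + s * v j).toNat : ℤ) : ℚ) = c * z j + s * v j := by
    rw [Int.toNat_of_nonneg hnonneg]; push_cast; ring
  rw [Int.cast_natCast] at hcast
  rw [hcast, hz j]
  push_cast
  ring

/-- A multiset of size `L` is the multiset of entries of some tuple of length `L`. -/
lemma Multiset.exists_map_univ_eq {T : Type*} {L : ℕ} (M : Multiset T) (hM : M.card = L) :
    ∃ x : Fin L → T, (Finset.univ : Finset (Fin L)).val.map x = M := by
  induction M using Quotient.inductionOn with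
  | h l =>
    obtain rfl : l.length = L := hM
    exact ⟨l.get, by simp [Fin.univ_val_map]⟩

/-- Two families with the same multiset of values differ by a permutation of the indices. -/
lemma Multiset.exists_perm_of_map_univ_eq {I T : Type*} [Fintype I] {x y : I → T}
    (h : (Finset.univ : Finset I).val.map x = (Finset.univ : Finset I).val.map y) :
    ∃ π : Equiv.Perm I, y ∘ π = x := by
  classical
  have hcount : ∀ (z : I → T) (a : T),
      Fintype.card {i // z i = a} = ((Finset.univ : Finset I).val.map z).count a := by
    intro z a
    rw [Fintype.card_subtype, Multiset.count_map, Finset.card_def, Finset.filter_val]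
    simp_rw [eq_comm]
  have e : ∀ a, {i // x i = a} ≃ {i // y i = a} := fun a =>
    Fintype.equivOfCardEq (by rw [hcount, hcount, h])
  refine ⟨(Equiv.sigmaFiberEquiv x).symm.trans
    ((Equiv.sigmaCongrRight e).trans (Equiv.sigmaFiberEquiv y)), funext fun i => ?_⟩
  exact (e (x i) ⟨i, rfl⟩).2

/-- A symmetric function depends only on the multiset of its arguments. -/
lemma IsSymmetric.eq_of_map_eq {A B : Type} {L : ℕ} {f : (Fin L → A) → B} (hf : IsSymmetric f)
    {x y : Fin L → A}
    (h : (Finset.univ : Finset (Fin L)).val.map x = (Finset.univ : Finset (Fin L)).val.map y) :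
    f x = f y := by
  obtain ⟨π, rfl⟩ := Multiset.exists_perm_of_map_univ_eq h
  exact hf π y

/-- If a promise template `(𝐀,𝐁)` over finite domains has symmetric
polymorphisms of arbitrarily large arity, then for any instance `𝐗`, the existence of a
BLP solution together with a refining affine solution implies `𝐗 → 𝐁`. -/
theorem stmt_1 {ι : Type} [Fintype ι] {ar : ι → ℕ} (har : ∀ R, 1 ≤ ar R)
    {A B : Type} [Fintype A] [DecidableEq A] [Fintype B]
    (RA : ∀ R : ι, Finset (Fin (ar R) → A))
    (RB : ∀ R : ι, Finset (Fin (ar R) → B))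
    (hAB : ∃ h : A → B, IsHom RA RB h)
    (hsym : ∀ N : ℕ, ∃ (L : ℕ) (f : (Fin L → A) → B),
      N ≤ L ∧ IsPolymorphism RA RB f ∧ IsSymmetric f)
    {X : Type} [Fintype X]
    (RX : ∀ R : ι, Finset (Fin (ar R) → X))
    (w : X → A → ℚ) (p : ∀ R : ι, (Fin (ar R) → X) → (Fin (ar R) → A) → ℚ)
    (r : X → A → ℤ) (q : ∀ R : ι, (Fin (ar R) → X) → (Fin (ar R) → A) → ℤ)
    (hblp : IsBLPSol RX RA w p) (haff : IsAffSol RX RA r q)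
    (href : Refines RX RA w p r q) :
    ∃ σ : X → B, IsHom RX RB σ := by
  classical
  obtain ⟨hw0, hp0, hw1, hp1, hpw⟩ := hblp
  obtain ⟨hr1, hq1, hqr⟩ := haff
  obtain ⟨hwr, hpq⟩ := href
  let J := (X × A) ⊕ (Σ R : ι, {t // t ∈ RX R} × {y // y ∈ RA R})
  let u : J → ℚ := Sum.elim (fun z => w z.1 z.2) (fun z => p z.1 z.2.1 z.2.2)
  let v : J → ℤ := Sum.elim (fun z => r z.1 z.2) (fun z => q z.1 z.2.1 z.2.2)
  obtain ⟨N, hN⟩ := exists_add_eq_forall_natCast_eq u v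
    (by
      rintro (z | z)
      · exact hw0 _ _
      · exact hp0 _ _ z.2.1.2 _ z.2.2.2)
    (by
      rintro (z | z)
      · exact hwr _ _
      · exact hpq _ _ z.2.1.2 _ z.2.2.2)
  obtain ⟨L, f, hL, hpol, hf⟩ := hsym N
  obtain ⟨α, s, hαs, hn⟩ := hN L hL
  have hαs' : (α : ℚ) + s = L := by exact_mod_cast hαs
  have hW : ∀ i a, ∃ n : ℕ, (n : ℚ) = α * w i a + s * r i a := fun i a => hn (.inl (i, a))
  choose W hW using hW
  have hWcard : ∀ i, (∑ a, W i a • ({a} : Multiset A)).card = L := by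
    intro i
    have hw := hw1 i
    have hr : ∑ a, (r i a : ℚ) = 1 := by exact_mod_cast hr1 i
    have : ((∑ a, W i a : ℕ) : ℚ) = L := by
      push_cast
      simp_rw [hW, Finset.sum_add_distrib, ← Finset.mul_sum]
      rw [hw, hr, mul_one, mul_one, hαs']
    simpa using (by exact_mod_cast this : ∑ a, W i a = L)
  choose x hx using fun i => Multiset.exists_map_univ_eq _ (hWcard i)
  refine ⟨fun i => f (x i), fun R t ht => ?_⟩
  have hQ : ∀ y, ∃ n : ℕ, y ∈ RA R → (n : ℚ) = α * p R t y + s * q R t y := by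
    intro y
    by_cases hy : y ∈ RA R
    · obtain ⟨n, h⟩ := hn (.inr ⟨R, ⟨t, ht⟩, ⟨y, hy⟩⟩)
      exact ⟨n, fun _ => h⟩
    · exact ⟨0, fun h => absurd h hy⟩
  choose Q hQ using hQ
  have hsum : ∀ S ⊆ RA R, ((∑ y ∈ S, Q y : ℕ) : ℚ)
      = α * (∑ y ∈ S, p R t y) + s * ((∑ y ∈ S, q R t y : ℤ) : ℚ) := by
    intro S hS
    push_cast
    rw [Finset.mul_sum, Finset.mul_sum, ← Finset.sum_add_distrib]
    exact Finset.sum_congr rfl fun y hy => hQ y (hS hy)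
  have hQcard : (∑ y ∈ RA R, Q y • ({y} : Multiset (Fin (ar R) → A))).card = L := by
    have := hsum _ subset_rfl
    rw [hp1 R t ht, hq1 R t ht, Int.cast_one, mul_one, mul_one, hαs'] at this
    simpa using (by exact_mod_cast this : ∑ y ∈ RA R, Q y = L)
  obtain ⟨y, hy⟩ := Multiset.exists_map_univ_eq _ hQcard
  have hyR : ∀ l, y l ∈ RA R := by
    intro l
    have hmem : y l ∈ (Finset.univ : Finset (Fin L)).val.map y :=
      Multiset.mem_map_of_mem _ (Finset.mem_univ l)
    rw [hy, Multiset.mem_sum] at hmem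
    obtain ⟨z, hz, hyz⟩ := hmem
    rwa [Multiset.mem_singleton.1 (Multiset.mem_of_mem_nsmul hyz)]
  convert hpol R y hyR using 2 with k
  refine hf.eq_of_map_eq ?_
  have hQW : ∀ a, ∑ y ∈ (RA R).filter (fun y => y k = a), Q y = W (t k) a := by
    intro a
    have := hsum _ (Finset.filter_subset (fun y => y k = a) (RA R))
    rw [hpw R t ht, hqr R t ht, ← hW] at this
    exact_mod_cast this
  calc (Finset.univ : Finset (Fin L)).val.map (x (t k))
      = ∑ a, W (t k) a • ({a} : Multiset A) := hx (t k)
    _ = ∑ a, ∑ y ∈ (RA R).filter (fun y => y k = a), Q y • ({y k} : Multiset A) := by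
      refine Finset.sum_congr rfl fun a _ => ?_
      rw [← hQW, Finset.sum_smul]
      exact Finset.sum_congr rfl fun y hy => by rw [(Finset.mem_filter.1 hy).2]
    _ = ∑ y ∈ RA R, Q y • ({y k} : Multiset A) := Finset.sum_fiberwise _ _ _
    _ = (∑ y ∈ RA R, Q y • ({y} : Multiset (Fin (ar R) → A))).map (fun y => y k) := by
      rw [← Multiset.coe_mapAddMonoidHom, map_sum]
      simp [Multiset.map_nsmul]
    _ = (Finset.univ : Finset (Fin L)).val.map (fun l => y l k) := by
      rw [← hy, Multiset.map_map]
      rfl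
end

section
/- Let (𝐀,𝐁) be a promise template over finite domains and let f : A^L → B be a symmetric polymorphism of (𝐀,𝐁) of arity L. Let 𝐗 be an instance. Suppose we are given, for each variable i, nonnegative integers W_i(a) for a ∈ A with Σ_{a∈A} W_i(a) = L, and, for each constraint j = (R_j, x̄^j), nonnegative integers P_j(y) for y ∈ R_j^𝐀 with Σ_{y∈R_j^𝐀} P_j(y) = L, such that W_i(a) = Σ_{y∈R_j^𝐀 : y|_i = a} P_j(y) whenever variable i occurs in constraint j. Then for any choice of tuples t_i ∈ A^L in which each a ∈ A occurs exactly W_i(a) times, the map sending variable i to f(t_i) is a homomorphism from 𝐗 to 𝐁. -/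
/-- Two maps on a finite type whose fibres have the same cardinalities differ by a permutation. -/
theorem exists_perm_comp_eq_of_card_fiber_eq {α β : Type*} [Fintype α] [DecidableEq β]
    (u v : α → β)
    (h : ∀ b, (Finset.univ.filter (fun l => u l = b)).card =
      (Finset.univ.filter (fun l => v l = b)).card) :
    ∃ π : Equiv.Perm α, v ∘ π = u := by
  have hcard : ∀ b, Fintype.card {l // u l = b} = Fintype.card {l // v l = b} := fun b => by
    rw [Fintype.card_subtype, Fintype.card_subtype, h b]
  refine ⟨(Equiv.sigmaFiberEquiv u).symm.trans
    ((Equiv.sigmaCongrRight fun b => Fintype.equivOfCardEq (hcard b)).trans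
      (Equiv.sigmaFiberEquiv v)), funext fun l => ?_⟩
  exact (Fintype.equivOfCardEq (hcard (u l)) ⟨l, rfl⟩).2

/-- Nonnegative integer weights on a finite set with total `L` are realized as the histogram of a
sequence of length `L` in that set. -/
theorem exists_seq_card_filter_eq_sum {T : Type*} (S : Finset T) (p : T → ℕ) {L : ℕ}
    (hp : ∑ y ∈ S, p y = L) :
    ∃ x : Fin L → T, (∀ l, x l ∈ S) ∧ ∀ (q : T → Prop) [DecidablePred q],
      (Finset.univ.filter (fun l => q (x l))).card = ∑ y ∈ S.filter q, p y := by
  have hcard : Fintype.card (Fin L) = Fintype.card (Σ y : S, Fin (p y)) := by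
    simp only [Fintype.card_fin, Fintype.card_sigma]
    rw [← hp, Finset.sum_coe_sort S p]
  let e := Fintype.equivOfCardEq hcard
  refine ⟨fun l => (e l).1, fun l => (e l).1.2, fun q _ => ?_⟩
  rw [Finset.card_filter, Finset.sum_filter,
    Equiv.sum_comp e (fun s => if q s.1 then 1 else 0), Fintype.sum_sigma,
    ← Finset.sum_coe_sort S]
  refine Finset.sum_congr rfl fun y _ => ?_
  split_ifs <;> simp [*]

/-- Rounding with a symmetric polymorphism: if the integer weights
`W`, `P` satisfy the BLP-style marginal equations with total mass `L`, and each tuple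
`t i` realizes the histogram `W i`, then `i ↦ f (t i)` is a homomorphism to `𝐁`. -/
theorem stmt_8 {ι : Type} [Fintype ι] {ar : ι → ℕ} (har : ∀ R, 1 ≤ ar R)
    {A B : Type} [Fintype A] [DecidableEq A] [Fintype B]
    (RA : ∀ R : ι, Finset (Fin (ar R) → A))
    (RB : ∀ R : ι, Finset (Fin (ar R) → B))
    (hAB : ∃ h : A → B, IsHom RA RB h)
    {L : ℕ} (f : (Fin L → A) → B)
    (hpoly : IsPolymorphism RA RB f) (hsym : IsSymmetric f)
    {X : Type} [Fintype X]
    (RX : ∀ R : ι, Finset (Fin (ar R) → X))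
    (W : X → A → ℕ) (hW : ∀ i, ∑ a, W i a = L)
    (P : ∀ R : ι, (Fin (ar R) → X) → (Fin (ar R) → A) → ℕ)
    (hP : ∀ R : ι, ∀ xb ∈ RX R, ∑ y ∈ RA R, P R xb y = L)
    (hmarg : ∀ R : ι, ∀ xb ∈ RX R, ∀ (k : Fin (ar R)) (a : A),
      ∑ y ∈ (RA R).filter (fun y => y k = a), P R xb y = W (xb k) a)
    (t : X → Fin L → A)
    (ht : ∀ i a, (Finset.univ.filter (fun l => t i l = a)).card = W i a) :
    IsHom RX RB (fun i => f (t i)) := by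
  intro R xb hxb
  obtain ⟨x, hxS, hx⟩ := exists_seq_card_filter_eq_sum (RA R) (P R xb) (hP R xb hxb)
  have key : (fun k => f (t (xb k))) = fun k => f (fun l => x l k) := by
    funext k
    obtain ⟨π, hπ⟩ := exists_perm_comp_eq_of_card_fiber_eq (t (xb k)) (fun l => x l k) fun a => by
      rw [ht, ← hmarg R xb hxb k a, ← hx fun y => y k = a]
    rw [← hπ, hsym]
  exact key ▸ hpoly R x hxS
end

section
/- Let 𝓜 and 𝓝 be minions such that 𝓝^{(L)} is finite for every arity L. Suppose 𝓜 (viewed as the disjoint union of its 𝓜^{(L)}) equals the union of an increasing chain of finite subsets 𝓜_1 ⊆ 𝓜_2 ⊆ ⋯, and suppose that for every k there exists a subminion 𝓜'_k of 𝓜 (a family of subsets 𝓜'^{(L)}_k ⊆ 𝓜^{(L)} closed under all minor operations) with 𝓜_k ⊆ 𝓜'_k and a minion homomorphism from 𝓜'_k to 𝓝. Then there exists a minion homomorphism from 𝓜 to 𝓝. -/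
/-- An abstract minion: a family of sets indexed by arity, with minor operations. -/
structure Minion where
  carrier : ℕ → Type
  map : ∀ {L L' : ℕ}, (Fin L → Fin L') → carrier L → carrier L'
  map_id : ∀ (L : ℕ) (f : carrier L), map id f = f
  map_comp : ∀ {L L' L'' : ℕ} (π : Fin L → Fin L') (τ : Fin L' → Fin L'')
    (f : carrier L), map τ (map π f) = map (τ ∘ π) f

/-- A minion homomorphism: preserves arities and minors. -/
structure MinionHom (M N : Minion) where
  toFun : ∀ L, M.carrier L → N.carrier L
  map_minor : ∀ {L L' : ℕ} (π : Fin L → Fin L') (f : M.carrier L),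
    toFun L' (M.map π f) = N.map π (toFun L f)

/-- Compactness for minions: if `𝓝` has finite arity-classes, `𝓜` is
the union of an increasing chain of finite subsets `𝓜_k`, and each `𝓜_k` is contained
in a subminion of `𝓜` admitting a minion homomorphism to `𝓝`, then `𝓜` admits a minion
homomorphism to `𝓝`. -/
theorem stmt_12 (M N : Minion) (hNfin : ∀ L, Finite (N.carrier L))
    (chain : ℕ → Set (Σ L, M.carrier L))
    (hfin : ∀ k, (chain k).Finite)
    (hmono : ∀ k, chain k ⊆ chain (k + 1))
    (hcover : ∀ x : Σ L, M.carrier L, ∃ k, x ∈ chain k)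
    (hsub : ∀ k, ∃ S : ∀ L, Set (M.carrier L),
      (∀ (L L' : ℕ) (π : Fin L → Fin L') (g : M.carrier L), g ∈ S L → M.map π g ∈ S L') ∧
      (∀ x ∈ chain k, x.2 ∈ S x.1) ∧
      ∃ ξ : ∀ (L : ℕ) (g : M.carrier L), g ∈ S L → N.carrier L,
        ∀ (L L' : ℕ) (π : Fin L → Fin L') (g : M.carrier L) (hg : g ∈ S L)
          (hg' : M.map π g ∈ S L'),
          ξ L' (M.map π g) hg' = N.map π (ξ L g hg)) :
    Nonempty (MinionHom M N) := by
  choose S hclosed hchain ξ hξ using hsub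
  have hlimit : ∀ (L : ℕ) (g : M.carrier L), ∃ n : N.carrier L,
      ∀ᶠ k in (Filter.hyperfilter ℕ : Filter ℕ), ∃ h : g ∈ S k L, ξ k L g h = n := by
    intro L g
    have := hNfin L
    rw [← Ultrafilter.eventually_exists_iff]
    obtain ⟨k₀, hk₀⟩ := hcover ⟨L, g⟩
    filter_upwards [Nat.hyperfilter_le_atTop (Filter.eventually_ge_atTop k₀)] with k hk
    have h : g ∈ S k L := hchain k ⟨L, g⟩ (monotone_nat_of_le_succ hmono hk hk₀)
    exact ⟨ξ k L g h, h, rfl⟩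
  choose F hF using hlimit
  refine ⟨⟨F, fun {L L'} π f => ?_⟩⟩
  obtain ⟨k, ⟨h', e'⟩, h, e⟩ := ((hF L' (M.map π f)).and (hF L f)).exists
  rw [← e', ← e, hξ]
end
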